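/- arXiv:1405.5607 — 10 statements merged into one kernel-verified Lean document; each statement's English description precedes it below -/
import Mathlib

section
/- Let w be a word of length n over an alphabet Σ, and let u be a nonempty word with a border s such that s ≠ u, so that u = sx = ys for some words x and y (y is then nonempty). Assume n = 2|u| − |s|. If (u, n) is a representation of the circular word w_o, then (y, n) is also a representation of w_o. -/
/-- Words `x` and `y` are conjugates: `x = s ++ t` and `y = t ++ s`. -/
def IsConjugate {α : Type*} (x y : List α) : Prop :=
  ∃ s t : List α, x = s ++ t ∧ y = t ++ s

/-- The fractional power `u^(p/|u|)`: the word of length `p` whose `(i+1)`-st letter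
is the `((i mod |u|)+1)`-st letter of `u` (for nonempty `u`). -/
def fracPow {α : Type*} (u : List α) (p : ℕ) : List α :=
  ((List.replicate (p / u.length + 1) u).flatten).take p

/-- `(u, n)` is a representation of the circular word `w_o`. -/
def IsRepresentation {α : Type*} (w u : List α) (n : ℕ) : Prop :=
  u ≠ [] ∧ u.length ≤ n ∧ n = w.length ∧ IsConjugate (fracPow u n) w

/-- `(u, n)` is a minimal representation of the circular word `w_o`. -/
def IsMinimalRepresentation {α : Type*} (w u : List α) (n : ℕ) : Prop :=
  IsRepresentation w u n ∧
    ∀ u' : List α, IsRepresentation w u' n → u.length ≤ u'.length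

/-- `b` is a border of `w`: a common prefix and suffix. -/
def IsBorder {α : Type*} (b w : List α) : Prop := b <+: w ∧ b <:+ w

/-- `p` is a branching prefix for `w`: two distinct letters can extend `p`
inside conjugates of `w`. -/
def IsBranchingPrefix {α : Type*} (p w : List α) : Prop :=
  ∃ c d : α, c ≠ d ∧
    (∃ v : List α, IsConjugate v w ∧ (p ++ [c]) <+: v) ∧
    (∃ v : List α, IsConjugate v w ∧ (p ++ [d]) <+: v)

/-- The finite Fibonacci words over the two-letter alphabet `Bool`
(`true` plays the role of `a`, `false` of `b`): `f₁ = b`, `f₂ = a`,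
`fₙ = fₙ₋₁ fₙ₋₂`. -/
def fibWord : ℕ → List Bool
  | 0 => []
  | 1 => [false]
  | 2 => [true]
  | (n+3) => fibWord (n+2) ++ fibWord (n+1)

theorem isConjugate_iff_isRotated {α : Type*} (x y : List α) :
    IsConjugate x y ↔ x ~r y := by
  constructor
  · rintro ⟨s, t, rfl, rfl⟩
    exact List.isRotated_append
  · rintro ⟨n, rfl⟩
    refine ⟨x.take (n % x.length), x.drop (n % x.length), ?_, ?_⟩
    · simp
    · exact List.rotate_eq_drop_append_take_mod

theorem prefix_pow_append {α : Type*} (s x y : List α) (h : y ++ s = s ++ x) (k : ℕ) :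
    s <+: (List.replicate k y).flatten ++ s := by
  induction k with
  | zero => simp
  | succ k ih =>
    have h1 : s <+: y ++ s := by rw [h]; exact List.prefix_append _ _
    refine h1.trans ?_
    rw [List.replicate_succ, List.flatten_cons, List.append_assoc]
    exact (List.prefix_append_right_inj y).2 ih

theorem fracPow_eq {α : Type*} (y v : List α) (n : ℕ) (hn : n = v.length)
    (h : v <+: (List.replicate (n / y.length + 1) y).flatten) : fracPow y n = v := by
  unfold fracPow
  rw [List.prefix_iff_eq_take] at h
  rw [← hn] at h
  exact h.symm

/-- If u = s ++ x = y ++ s with border s ≠ u, n = 2|u| - |s|,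
and (u, n) is a representation of w_o, then so is (y, n). -/
theorem border_gives_representation {α : Type*} (w u s x y : List α) (n : ℕ)
    (hu : u ≠ []) (hsx : u = s ++ x) (hys : u = y ++ s) (hsu : s ≠ u)
    (hn : n = 2 * u.length - s.length)
    (hrep : IsRepresentation w u n) :
    IsRepresentation w y n := by
  obtain ⟨-, hle, hw, hc⟩ := hrep
  have hy : y ≠ [] := by
    rintro rfl
    exact hsu (by simpa using hys.symm)
  have hyl : 0 < y.length := List.length_pos_iff.2 hy
  have hul : u.length = y.length + s.length := by rw [hys]; simp
  have hn' : n = u.length + y.length := by omega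
  have h1 : fracPow u n = u ++ y := by
    apply fracPow_eq _ _ _ (by simpa using hn')
    have : 1 ≤ n / u.length := (Nat.one_le_div_iff (by omega)).2 hle
    obtain ⟨k, hk⟩ := Nat.exists_eq_add_of_le this
    rw [hk, show 1 + k + 1 = (k + 1) + 1 by ring, List.replicate_succ, List.flatten_cons,
      List.prefix_append_right_inj, List.replicate_succ, List.flatten_cons]
    have h2 : y <+: u := by rw [hys]; exact List.prefix_append _ _
    exact h2.trans (List.prefix_append _ _)
  have h2 : fracPow y n = y ++ u := by
    apply fracPow_eq _ _ _ (by simp; omega)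
    have hlt : n < (n / y.length + 1) * y.length := by
      have := Nat.lt_mul_div_succ n hyl
      rwa [mul_comm] at this
    have hp : 1 ≤ n / y.length := (Nat.one_le_div_iff hyl).2 (by omega)
    obtain ⟨k, hk⟩ := Nat.exists_eq_add_of_le hp
    rw [hk] at hlt ⊢
    rw [show 1 + k + 1 = (k + 1) + 1 by ring] at hlt ⊢
    rw [List.replicate_succ, List.flatten_cons, List.prefix_append_right_inj,
      List.replicate_succ, List.flatten_cons, hys, List.prefix_append_right_inj]
    refine List.prefix_of_prefix_length_le (prefix_pow_append s x y (hys.symm.trans hsx) k)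
      (List.prefix_append _ _) ?_
    simp only [List.length_flatten, List.map_replicate, List.sum_replicate, smul_eq_mul]
    rw [add_mul, add_mul] at hlt
    omega
  refine ⟨hy, by omega, hw, ?_⟩
  rw [isConjugate_iff_isRotated] at hc ⊢
  rw [h1] at hc
  rw [h2]
  exact List.isRotated_append.trans hc
end

section
/- Every word u over a two-letter alphabet with |u| ≥ 3 has a conjugate that has a non-trivial border, i.e., there exists a conjugate v of u and a word b with b ≠ ε and b ≠ v such that b is both a prefix and a suffix of v. -/
theorem adj_aux (p t : List Bool) (x : Bool) :
    ∃ v b : List Bool, IsConjugate v (p ++ x :: x :: t) ∧ b ≠ [] ∧ b ≠ v ∧ b <+: v ∧ b <:+ v := by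
  refine ⟨(x :: t) ++ (p ++ [x]), [x], ⟨x :: t, p ++ [x], rfl, by simp⟩, by simp, ?_,
    ⟨t ++ (p ++ [x]), by simp⟩, ⟨x :: t ++ p, by simp⟩⟩
  intro h
  have := congrArg List.length h
  simp at this

/-- Every word over a two-letter alphabet of length at least 3 has a
conjugate with a non-trivial border. -/
theorem conjugate_with_nontrivial_border (u : List Bool) (h : 3 ≤ u.length) :
    ∃ v b : List Bool, IsConjugate v u ∧ b ≠ [] ∧ b ≠ v ∧ b <+: v ∧ b <:+ v := by
  match u, h with
  | a :: b :: c :: t, _ =>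
    by_cases h1 : a = b
    · subst h1; exact adj_aux [] (c :: t) a
    by_cases h2 : b = c
    · subst h2; exact adj_aux [a] t b
    have h3 : c = a := by revert h1 h2; cases a <;> cases b <;> cases c <;> simp
    subst h3
    match t with
    | [] => exact ⟨[c, b, c], [c], ⟨[], [c, b, c], by simp, by simp⟩, by simp, by simp,
        ⟨[b, c], by simp⟩, ⟨[c, b], by simp⟩⟩
    | d :: t =>
      by_cases h4 : c = d
      · subst h4; exact adj_aux [c, b] t c
      have h5 : d = b := by revert h1 h4; cases b <;> cases c <;> cases d <;> simp
      subst h5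
      refine ⟨([c, d] ++ t) ++ [c, d], [c, d], ⟨[c, d] ++ t, [c, d], rfl, by simp⟩, by simp, ?_,
        ⟨t ++ [c, d], by simp⟩, ⟨[c, d] ++ t, by simp⟩⟩
      intro h
      have := congrArg List.length h
      simp at this
end

section
/- Let u be a word over the two-letter alphabet {a, b} with |u| ≥ 3. Then there exists a nonempty word v with |v| < |u| such that the fractional power v^{|u|/|v|} is a conjugate of u; in other words, the circular word u_o has a representation (v, |u|) with |v| < |u|, so no minimal root of a circular word over {a, b} has length greater than 2. -/
theorem fracPow_border {α : Type*} (p r : List α) (h : p ++ r ≠ []) :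
    fracPow (p ++ r) (p ++ r ++ p).length = p ++ r ++ p := by
  unfold fracPow
  have hl : 0 < (p ++ r).length := List.length_pos_iff.mpr h
  have : 1 ≤ (p ++ r ++ p).length / (p ++ r).length := by
    rw [Nat.le_div_iff_mul_le hl]; simp
  obtain ⟨k, hk⟩ := Nat.exists_eq_add_of_le' this
  rw [hk, List.replicate_succ, List.replicate_succ]
  have e : ((p ++ r) :: (p ++ r) :: List.replicate k (p ++ r)).flatten
      = (p ++ r ++ p) ++ (r ++ (List.replicate k (p ++ r)).flatten) := by simp
  rw [e, List.take_left']
  rfl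

theorem border_case (u p r : List Bool) (hp : p ≠ []) (hr : IsConjugate (p ++ r ++ p) u) :
    ∃ v : List Bool, v ≠ [] ∧ v.length < u.length ∧
      IsConjugate (fracPow v u.length) u := by
  have hn : p ++ r ≠ [] := by simp [hp]
  have hl : u.length = (p ++ r ++ p).length := by
    obtain ⟨s, t, h1, h2⟩ := hr
    rw [h1, h2]; simp [Nat.add_comm]
  have := List.length_pos_iff.mpr hp
  refine ⟨p ++ r, hn, ?_, ?_⟩
  · rw [hl]; simp; omega
  · rw [hl, fracPow_border p r hn]; exact hr

theorem adj_or_chain (u : List Bool) :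
    (∃ s c t, u = s ++ c :: c :: t) ∨ u.IsChain (· ≠ ·) := by
  induction u with
  | nil => right; simp
  | cons a l ih =>
    rcases ih with ⟨s, c, t, rfl⟩ | h
    · exact Or.inl ⟨a :: s, c, t, rfl⟩
    · cases l with
      | nil => right; simp
      | cons b l =>
        by_cases hab : a = b
        · subst hab; exact Or.inl ⟨[], a, l, rfl⟩
        · right; exact List.isChain_cons_cons.mpr ⟨hab, h⟩

theorem shorter_representation_of_two_letter_word (u : List Bool) (h : 3 ≤ u.length) :
    ∃ v : List Bool, v ≠ [] ∧ v.length < u.length ∧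
      IsConjugate (fracPow v u.length) u := by
  rcases adj_or_chain u with ⟨s, c, t, rfl⟩ | hc
  · exact border_case _ [c] (t ++ s) (by simp) ⟨c :: t, s ++ [c], by simp, by simp⟩
  · match u, h, hc with
    | x :: y :: m, h, hc =>
      rcases List.eq_nil_or_concat m with rfl | ⟨m, q, rfl⟩
      · simp at h
      by_cases hq : q = x
      · subst hq
        exact border_case _ [q] (y :: m) (by simp) ⟨[], q :: y :: m ++ [q], by simp, by simp⟩
      · have hxy : x ≠ y := by
          rw [List.isChain_cons_cons] at hc; exact hc.1
        have hqy : q = y := by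
          revert hq hxy; cases q <;> cases x <;> cases y <;> simp
        subst hqy
        rcases List.eq_nil_or_concat m with rfl | ⟨m, p, rfl⟩
        · simp at hc
        have hpq : p ≠ q := by
          have : (([x, q] ++ m) ++ [p, q]).IsChain (· ≠ ·) := by simpa using hc
          have := (List.isChain_append.mp this).2.1
          simpa using this
        have hpx : p = x := by
          revert hpq hxy; cases q <;> cases x <;> cases p <;> simp
        subst hpx
        exact border_case _ [p, q] m (by simp) ⟨[], [p, q] ++ m ++ [p, q], by simp, by simp⟩
end

section
/- Let w be a word over an alphabet Σ and let n > 0 be an integer. If there exists a branching prefix of length n for w (equivalently, two distinct conjugates of w whose longest common prefix has length n), then there exists a branching prefix of length n − 1 for w. -/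
theorem isConjugate_rot_aux {α : Type*} {a : α} {x w : List α}
    (h : IsConjugate (a :: x) w) : IsConjugate (x ++ [a]) w := by
  obtain ⟨s, t, h1, h2⟩ := h
  cases s with
  | nil =>
    refine ⟨x, [a], rfl, ?_⟩
    simp at h1 h2
    simp [h2, ← h1]
  | cons b s =>
    simp at h1
    obtain ⟨rfl, rfl⟩ := h1
    exact ⟨s, t ++ [a], by simp, by simp [h2]⟩

theorem branching_ext_aux {α : Type*} {a c : α} {q w : List α}
    (h : ∃ v : List α, IsConjugate v w ∧ ((a :: q) ++ [c]) <+: v) :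
    ∃ v : List α, IsConjugate v w ∧ (q ++ [c]) <+: v := by
  obtain ⟨v, hv, r, rfl⟩ := h
  exact ⟨(q ++ [c] ++ r) ++ [a], isConjugate_rot_aux (by simpa using hv), ⟨r ++ [a], by simp⟩⟩

/-- A branching prefix of length n > 0 for w implies a branching
prefix of length n - 1 for w. -/
theorem branching_prefix_descend {α : Type*} (w : List α) (n : ℕ) (hn : 0 < n)
    (h : ∃ p : List α, p.length = n ∧ IsBranchingPrefix p w) :
    ∃ p : List α, p.length = n - 1 ∧ IsBranchingPrefix p w := by
  obtain ⟨p, hp, c, d, hcd, h1, h2⟩ := h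
  cases p with
  | nil => simp at hp; omega
  | cons a q =>
    exact ⟨q, by simp at hp; omega, c, d, hcd, branching_ext_aux h1, branching_ext_aux h2⟩
end

section
/- Let w be a word over the two-letter alphabet {a, b} with |w| ≥ 2. If there exists a branching prefix of length |w| − 2 for w, then for every m with 0 ≤ m ≤ |w| − 2 there is exactly one branching prefix of length m for w. -/
theorem ubp_conj (v w : List Bool) (hw : 2 ≤ w.length) :
    IsConjugate v w ↔ ∃ i < w.length, w.rotate i = v := by
  constructor
  · rintro ⟨s, t, rfl, rfl⟩
    have h : (t ++ s).rotate t.length = s ++ t := List.rotate_append_length_eq t s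
    refine ⟨t.length % (t ++ s).length, Nat.mod_lt _ (by omega), ?_⟩
    rw [List.rotate_mod, h]
  · rintro ⟨i, hi, rfl⟩
    refine ⟨w.drop i, w.take i, ?_, (List.take_append_drop i w).symm⟩
    exact List.rotate_eq_drop_append_take hi.le

def ubpF (w : List Bool) (m : ℕ) : Finset (List Bool) :=
  (Finset.range w.length).image (fun i => (w.rotate i).take m)

theorem ubp_mem (w : List Bool) (hw : 2 ≤ w.length) (q : List Bool) (m : ℕ) (hm : m ≤ w.length) :
    q ∈ ubpF w m ↔ q.length = m ∧ ∃ v, IsConjugate v w ∧ q <+: v := by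
  simp only [ubpF, Finset.mem_image, Finset.mem_range]
  constructor
  · rintro ⟨i, hi, rfl⟩
    refine ⟨by simp [hm], w.rotate i, (ubp_conj _ w hw).2 ⟨i, hi, rfl⟩, List.take_prefix _ _⟩
  · rintro ⟨hl, v, hv, hq⟩
    obtain ⟨i, hi, rfl⟩ := (ubp_conj _ w hw).1 hv
    refine ⟨i, hi, ?_⟩
    rw [List.prefix_iff_eq_take] at hq
    rw [hq, hl]

theorem ubp_tail (w : List Bool) (hw : 2 ≤ w.length) (x : Bool) (q : List Bool)
    (h : ∃ v, IsConjugate v w ∧ (x :: q) <+: v) : ∃ v, IsConjugate v w ∧ q <+: v := by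
  obtain ⟨v, hv, r, rfl⟩ := h
  refine ⟨q ++ r ++ [x], ?_, ⟨r ++ [x], by simp⟩⟩
  obtain ⟨i, hi, h⟩ := (ubp_conj _ w hw).1 hv
  rw [ubp_conj _ w hw]
  refine ⟨(i + 1) % w.length, Nat.mod_lt _ (by omega), ?_⟩
  rw [List.rotate_mod, ← List.rotate_rotate, h]
  simp

theorem ubp_br_tail (w : List Bool) (hw : 2 ≤ w.length) (x : Bool) (q : List Bool)
    (h : IsBranchingPrefix (x :: q) w) : IsBranchingPrefix q w := by
  obtain ⟨c, d, hcd, h1, h2⟩ := h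
  exact ⟨c, d, hcd, ubp_tail w hw x _ h1, ubp_tail w hw x _ h2⟩

theorem ubp_exists (w : List Bool) (hw : 2 ≤ w.length) (p : List Bool)
    (h : IsBranchingPrefix p w) (m : ℕ) (hm : m ≤ p.length) :
    ∃ q : List Bool, q.length = m ∧ IsBranchingPrefix q w := by
  induction p with
  | nil => exact ⟨[], by simp at hm ⊢; omega, h⟩
  | cons x q ih =>
    rcases Nat.lt_or_ge q.length m with h1 | h1
    · exact ⟨x :: q, by simp at hm ⊢; omega, h⟩
    · exact ih (ubp_br_tail w hw x q h) h1

open Classical in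
theorem ubp_step (w : List Bool) (hw : 2 ≤ w.length) (m : ℕ) (hm : m + 1 ≤ w.length) :
    (ubpF w m).card + ((ubpF w m).filter (fun p => IsBranchingPrefix p w)).card
      ≤ (ubpF w (m+1)).card := by
  have hmaps : ∀ q ∈ ubpF w (m+1), q.dropLast ∈ ubpF w m := by
    intro q hq
    rw [ubp_mem w hw _ _ hm] at hq
    rw [ubp_mem w hw _ _ (by omega)]
    obtain ⟨hl, v, hv, hp⟩ := hq
    exact ⟨by simp [hl], v, hv, (List.dropLast_prefix q).trans hp⟩
  rw [Finset.card_eq_sum_card_fiberwise (f := List.dropLast) (t := ubpF w m) hmaps,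
    Finset.card_filter, Finset.card_eq_sum_ones, ← Finset.sum_add_distrib]
  apply Finset.sum_le_sum
  intro p hp
  have hpl : p.length = m := ((ubp_mem w hw _ _ (by omega)).1 hp).1
  split_ifs with hb
  · obtain ⟨c, d, hcd, h1, h2⟩ := hb
    have : ({p ++ [c], p ++ [d]} : Finset (List Bool)) ⊆
        (ubpF w (m+1)).filter (fun q => q.dropLast = p) := by
      intro q hq
      simp only [Finset.mem_insert, Finset.mem_singleton] at hq
      rw [Finset.mem_filter, ubp_mem w hw _ _ hm]
      rcases hq with rfl | rfl
      · exact ⟨⟨by simp [hpl], h1⟩, by simp⟩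
      · exact ⟨⟨by simp [hpl], h2⟩, by simp⟩
    have h3 := Finset.card_le_card this
    rwa [Finset.card_pair (by simpa using hcd)] at h3
  · simp only [add_zero]
    rw [Nat.succ_le_iff, Finset.card_pos]
    simp only [ubpF, Finset.mem_image, Finset.mem_range] at hp
    obtain ⟨i, hi, rfl⟩ := hp
    refine ⟨(w.rotate i).take (m+1), ?_⟩
    rw [Finset.mem_filter]
    refine ⟨Finset.mem_image.2 ⟨i, Finset.mem_range.2 hi, rfl⟩, ?_⟩
    rw [List.dropLast_eq_take, List.take_take]
    simp
    congr 1
    omega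

theorem ubp_mem_of_br (w : List Bool) (hw : 2 ≤ w.length) (p : List Bool)
    (hp : p.length ≤ w.length) (h : IsBranchingPrefix p w) : p ∈ ubpF w p.length := by
  rw [ubp_mem w hw _ _ hp]
  obtain ⟨c, d, _, ⟨v, hv, h1⟩, _⟩ := h
  exact ⟨rfl, v, hv, (List.prefix_append p [c]).trans h1⟩

/-- If a binary word w with |w| ≥ 2 has a branching prefix of
length |w| - 2, then for every m ≤ |w| - 2 there is exactly one branching
prefix of length m for w. -/
theorem unique_branching_prefixes (w : List Bool) (h2 : 2 ≤ w.length)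
    (hb : ∃ p : List Bool, p.length = w.length - 2 ∧ IsBranchingPrefix p w) :
    ∀ m : ℕ, m ≤ w.length - 2 →
      ∃! p : List Bool, p.length = m ∧ IsBranchingPrefix p w := by
  classical
  obtain ⟨p0, hl0, hp0⟩ := hb
  have hex : ∀ m, m ≤ w.length - 2 → ∃ q : List Bool, q.length = m ∧ IsBranchingPrefix q w :=
    fun m hm => ubp_exists w h2 p0 hp0 m (by omega)
  have hstep : ∀ m, m ≤ w.length - 2 → (ubpF w m).card + 1 ≤ (ubpF w (m+1)).card := by
    intro m hm
    refine le_trans ?_ (ubp_step w h2 m (by omega))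
    obtain ⟨q, rfl, hq⟩ := hex m hm
    have : 0 < ((ubpF w q.length).filter (fun p => IsBranchingPrefix p w)).card :=
      Finset.card_pos.2 ⟨q, Finset.mem_filter.2 ⟨ubp_mem_of_br w h2 q (by omega) hq, hq⟩⟩
    omega
  have hlow : ∀ m, m ≤ w.length - 1 → m + 1 ≤ (ubpF w m).card := by
    intro m
    induction m with
    | zero =>
      intro _
      rw [Nat.succ_le_iff, Finset.card_pos]
      exact ⟨_, Finset.mem_image.2 ⟨0, Finset.mem_range.2 (by omega), rfl⟩⟩
    | succ k ih =>
      intro hk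
      have := ih (by omega)
      have := hstep k (by omega)
      omega
  intro m hm
  obtain ⟨q, hql, hq⟩ := hex m hm
  refine ⟨q, ⟨hql, hq⟩, ?_⟩
  rintro r ⟨hrl, hr⟩
  by_contra hne
  have hm2 : m + 3 ≤ (ubpF w (m+1)).card := by
    have h3 := ubp_step w h2 m (by omega)
    have h4 : ({r, q} : Finset (List Bool)) ⊆
        (ubpF w m).filter (fun p => IsBranchingPrefix p w) := by
      intro x hx
      simp only [Finset.mem_insert, Finset.mem_singleton] at hx
      rw [Finset.mem_filter]
      rcases hx with rfl | rfl
      · exact ⟨hrl ▸ ubp_mem_of_br w h2 _ (by omega) hr, hr⟩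
      · exact ⟨hql ▸ ubp_mem_of_br w h2 _ (by omega) hq, hq⟩
    have h5 := Finset.card_le_card h4
    rw [Finset.card_pair hne] at h5
    have := hlow m (by omega)
    omega
  have hup : ∀ j, m + 1 + j ≤ w.length - 1 → m + 3 + j ≤ (ubpF w (m+1+j)).card := by
    intro j
    induction j with
    | zero => intro _; simpa using hm2
    | succ k ih =>
      intro hk
      have h6 := ih (by omega)
      have h7 := hstep (m+1+k) (by omega)
      have e : m + 1 + (k + 1) = m + 1 + k + 1 := by omega
      rw [e]
      omega
  have h8 := hup (w.length - 2 - m) (by omega)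
  have h9 : (ubpF w (m+1+(w.length - 2 - m))).card ≤ w.length := by
    unfold ubpF
    exact Finset.card_image_le.trans (by simp)
  omega
end

section
/- Let f_i denote the i-th finite Fibonacci word. For every i ≥ 1: for every ℓ with 0 ≤ ℓ ≤ |f_i| − 2 there is exactly one branching prefix of length ℓ for f_i, and there is no branching prefix of length |f_i| − 1 for f_i. In other words, the trie of the circular word (f_i)_o has exactly one branching node on every level except the last two, where it has none. -/
lemma isConjugate_iff_rot {v w : List Bool} : IsConjugate v w ↔ v ~r w := by
  constructor
  · rintro ⟨s, t, rfl, rfl⟩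
    exact List.isRotated_append
  · rintro ⟨n, rfl⟩
    refine ⟨v.take (n % v.length), v.drop (n % v.length), by simp, ?_⟩
    rw [List.rotate_eq_drop_append_take_mod]

/-- Nodes of the trie at level `l`. -/
def trieLevel (w : List Bool) (l : ℕ) : Finset (List Bool) :=
  w.cyclicPermutations.toFinset.image (List.take l)

/-- Branching nodes of the trie at level `l`. -/
def trieBranch (w : List Bool) (l : ℕ) : Finset (List Bool) :=
  (trieLevel w l).filter fun p => p ++ [true] ∈ trieLevel w (l+1) ∧ p ++ [false] ∈ trieLevel w (l+1)

lemma mem_trieLevel {w : List Bool} {l : ℕ} {p : List Bool} :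
    p ∈ trieLevel w l ↔ ∃ v, v ~r w ∧ v.take l = p := by
  simp [trieLevel, List.mem_cyclicPermutations_iff]

lemma mem_level_prefix {w p : List Bool} (hp : p.length ≤ w.length) :
    p ∈ trieLevel w p.length ↔ ∃ v, IsConjugate v w ∧ p <+: v := by
  rw [mem_trieLevel]
  constructor
  · rintro ⟨v, hv, h⟩
    exact ⟨v, isConjugate_iff_rot.2 hv, by rw [← h]; exact List.take_prefix _ _⟩
  · rintro ⟨v, hv, h⟩
    exact ⟨v, isConjugate_iff_rot.1 hv, (List.prefix_iff_eq_take.1 h).symm⟩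

lemma mem_trieBranch {w p : List Bool} {l : ℕ} (hl : l < w.length) :
    p ∈ trieBranch w l ↔ p.length = l ∧ IsBranchingPrefix p w := by
  have key : ∀ c, p.length = l → (p ++ [c] ∈ trieLevel w (l+1) ↔
      ∃ v, IsConjugate v w ∧ (p ++ [c]) <+: v) := by
    intro c h
    have := mem_level_prefix (w := w) (p := p ++ [c]) (by simp; omega)
    simpa [h] using this
  constructor
  · intro h
    simp only [trieBranch, Finset.mem_filter] at h
    obtain ⟨h1, h2, h3⟩ := h
    have hp : p.length = l := by
      obtain ⟨v, hv, rfl⟩ := mem_trieLevel.1 h1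
      have := hv.perm.length_eq
      simp; omega
    exact ⟨hp, true, false, by simp, (key _ hp).1 h2, (key _ hp).1 h3⟩
  · rintro ⟨hp, c, d, hcd, h1, h2⟩
    have h0 : p ∈ trieLevel w l := by
      obtain ⟨v, hv, hv'⟩ := h1
      rw [← hp]
      exact (mem_level_prefix (by omega)).2 ⟨v, hv, (List.prefix_append _ _).trans hv'⟩
    rw [← key _ hp] at h1 h2
    simp only [trieBranch, Finset.mem_filter]
    refine ⟨h0, ?_⟩
    cases c <;> cases d <;> simp_all

lemma card_step {w : List Bool} {l : ℕ} (hl : l < w.length) :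
    (trieLevel w l).card + (trieBranch w l).card ≤ (trieLevel w (l+1)).card := by
  set T := (trieLevel w l).filter fun p => p ++ [true] ∈ trieLevel w (l+1) with hT
  set F := (trieLevel w l).filter fun p => p ++ [false] ∈ trieLevel w (l+1) with hF
  have h1 : T ∩ F = trieBranch w l := by
    ext p; simp only [hT, hF, trieBranch, Finset.mem_inter, Finset.mem_filter]; tauto
  have h2 : T ∪ F = trieLevel w l := by
    ext p
    simp only [hT, hF, Finset.mem_union, Finset.mem_filter]
    constructor
    · tauto
    · intro hp
      obtain ⟨v, hv, rfl⟩ := mem_trieLevel.1 hp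
      have hlen := hv.perm.length_eq
      have hlt : l < v.length := by omega
      have hm : v.take l ++ [v[l]] ∈ trieLevel w (l+1) :=
        mem_trieLevel.2 ⟨v, hv, by simp⟩
      cases hc : v[l] <;> rw [hc] at hm <;> tauto
  have h3 := Finset.card_union_add_card_inter T F
  rw [h1, h2] at h3
  have inj : ∀ c : Bool, Function.Injective (fun p : List Bool => p ++ [c]) :=
    fun c => List.append_left_injective [c]
  have hd : Disjoint (T.image fun p => p ++ [true]) (F.image fun p => p ++ [false]) := by
    rw [Finset.disjoint_left]
    simp only [Finset.mem_image]
    rintro _ ⟨a, _, rfl⟩ ⟨b, _, h⟩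
    have := (List.append_inj' h rfl).2
    simp at this
  rw [h3, ← Finset.card_image_of_injective T (inj true),
    ← Finset.card_image_of_injective F (inj false), ← Finset.card_union_of_disjoint hd]
  apply Finset.card_le_card
  intro q
  simp only [hT, hF, Finset.mem_union, Finset.mem_image, Finset.mem_filter]
  rintro (⟨p, ⟨_, h⟩, rfl⟩ | ⟨p, ⟨_, h⟩, rfl⟩) <;> exact h

lemma branching_general (w : List Bool) (hw : w ≠ [])
    (hex : ∀ l, l + 2 ≤ w.length → ∃ p : List Bool, p.length = l ∧ IsBranchingPrefix p w) :
    (∀ ℓ : ℕ, ℓ + 2 ≤ w.length →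
      ∃! p : List Bool, p.length = ℓ ∧ IsBranchingPrefix p w) ∧
    ¬ ∃ p : List Bool, p.length = w.length - 1 ∧ IsBranchingPrefix p w := by
  have hpos : 0 < w.length := List.length_pos_of_ne_nil hw
  have hb : ∀ l, l + 2 ≤ w.length → 1 ≤ (trieBranch w l).card := by
    intro l hl
    obtain ⟨p, hp⟩ := hex l hl
    exact Finset.card_pos.2 ⟨p, (mem_trieBranch (by omega)).2 hp⟩
  have hN : (trieLevel w w.length).card ≤ w.length := by
    refine Finset.card_image_le.trans ((List.toFinset_card_le _).trans ?_)
    rw [List.length_cyclicPermutations_of_ne_nil _ hw]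
  have h0 : 1 ≤ (trieLevel w 0).card :=
    Finset.card_pos.2 ⟨[], mem_trieLevel.2 ⟨w, List.IsRotated.refl _, by simp⟩⟩
  have up : ∀ l, l + 1 ≤ w.length → l + 1 ≤ (trieLevel w l).card := by
    intro l
    induction l with
    | zero => intro _; simpa using h0
    | succ l ih =>
      intro h
      have := ih (by omega)
      have := hb l (by omega)
      have := card_step (w := w) (l := l) (by omega)
      omega
  have last := card_step (w := w) (l := w.length - 1) (by omega)
  rw [show w.length - 1 + 1 = w.length by omega] at last
  have down : ∀ k l, l + k + 1 = w.length → (trieLevel w l).card ≤ l + 1 := by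
    intro k
    induction k with
    | zero =>
      intro l h
      have : l = w.length - 1 := by omega
      subst this
      omega
    | succ k ih =>
      intro l h
      have := ih (l+1) (by omega)
      have := hb l (by omega)
      have := card_step (w := w) (l := l) (by omega)
      omega
  constructor
  · intro l hl
    obtain ⟨p, hp⟩ := hex l hl
    refine ⟨p, hp, ?_⟩
    intro q hq
    have h1 := card_step (w := w) (l := l) (by omega)
    have h2 := up l (by omega)
    have h3 := down (w.length - (l+1) - 1) (l+1) (by omega)
    exact Finset.card_le_one.1 (by omega : (trieBranch w l).card ≤ 1) q
      ((mem_trieBranch (by omega)).2 hq) p ((mem_trieBranch (by omega)).2 hp)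
  · rintro ⟨p, hp⟩
    have h1 := up (w.length - 1) (by omega)
    have h2 : 1 ≤ (trieBranch w (w.length - 1)).card :=
      Finset.card_pos.2 ⟨p, (mem_trieBranch (by omega)).2 hp⟩
    omega

lemma fib_swap (n : ℕ) : ∃ (p : List Bool) (x y : Bool), x ≠ y ∧
    fibWord (n+2) ++ fibWord (n+1) = p ++ [x, y] ∧
    fibWord (n+1) ++ fibWord (n+2) = p ++ [y, x] := by
  induction n with
  | zero => exact ⟨[], true, false, by simp, by simp [fibWord], by simp [fibWord]⟩
  | succ n ih =>
    obtain ⟨p, x, y, hxy, h1, h2⟩ := ih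
    refine ⟨fibWord (n+2) ++ p, y, x, hxy.symm, ?_, ?_⟩
    · rw [show fibWord (n+1+2) = fibWord (n+2) ++ fibWord (n+1) from rfl, List.append_assoc,
        show n+1+1 = n+2 from rfl, h2, List.append_assoc]
    · rw [show fibWord (n+1+2) = fibWord (n+2) ++ fibWord (n+1) from rfl,
        show n+1+1 = n+2 from rfl, h1, List.append_assoc]

lemma swap_exists {w p : List Bool} {x y : Bool} (hxy : x ≠ y) (h1 : w = p ++ [x, y])
    (h2 : (p ++ [y, x]) ~r w) (l : ℕ) (hl : l + 2 ≤ w.length) :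
    ∃ p : List Bool, p.length = l ∧ IsBranchingPrefix p w := by
  have hlen : l ≤ p.length := by rw [h1] at hl; simpa using hl
  have key : ∀ c d : Bool, (p ++ [c, d]) ~r w → ∃ v : List Bool, IsConjugate v w ∧
      (p.drop (p.length - l) ++ [c]) <+: v := by
    intro c d h
    refine ⟨(p.drop (p.length - l) ++ [c, d]) ++ p.take (p.length - l),
      isConjugate_iff_rot.2 (List.IsRotated.trans List.isRotated_append ?_), ?_⟩
    · rw [← List.append_assoc, List.take_append_drop]; exact h
    · exact ⟨[d] ++ p.take (p.length - l), by simp⟩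
  exact ⟨p.drop (p.length - l), by simp; omega, x, y, hxy,
    key x y (h1 ▸ List.IsRotated.refl _), key y x h2⟩

theorem fibWord_branching_prefixes (i : ℕ) (hi : 1 ≤ i) :
    (∀ ℓ : ℕ, ℓ + 2 ≤ (fibWord i).length →
      ∃! p : List Bool, p.length = ℓ ∧ IsBranchingPrefix p (fibWord i)) ∧
    ¬ ∃ p : List Bool, p.length = (fibWord i).length - 1 ∧
        IsBranchingPrefix p (fibWord i) := by
  match i, hi with
  | 1, _ => exact branching_general _ (by simp [fibWord]) (by simp [fibWord])
  | 2, _ => exact branching_general _ (by simp [fibWord]) (by simp [fibWord])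
  | n+3, _ =>
    obtain ⟨p, x, y, hxy, h1, h2⟩ := fib_swap n
    have hw : fibWord (n+3) = p ++ [x, y] := h1
    refine branching_general _ (by simp [hw]) (swap_exists hxy hw ?_)
    rw [← h2]
    exact List.isRotated_append
end

section
/- For all integers i, j with 2 ≤ i < j, every factor of f_i f_i of length at most |f_i| is a factor of f_j f_j; equivalently, every prefix of a conjugate of f_i is a prefix of a conjugate of f_j, i.e., the trie of the circular word (f_i)_o is a subtree of the trie of (f_j)_o. -/
theorem fibWord_step_aux (i : ℕ) (hi : 2 ≤ i) (v : List Bool)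
    (hl : v.length ≤ (fibWord i).length)
    (h : v <:+: (fibWord i ++ fibWord i)) :
    v <:+: (fibWord (i+1) ++ fibWord (i+1)) := by
  match i, hi, hl, h with
  | 2, _, hl, h =>
    match v, hl, h with
    | [], _, _ => exact List.nil_infix
    | [x], _, h => exact (by decide : ∀ x : Bool, [x] <:+: fibWord 2 ++ fibWord 2 →
        [x] <:+: fibWord 3 ++ fibWord 3) x h
    | _ :: _ :: _, hl, _ => simp [fibWord] at hl
  | 3, _, hl, h =>
    match v, hl, h with
    | [], _, _ => exact List.nil_infix
    | [x], _, h => exact (by decide : ∀ x : Bool, [x] <:+: fibWord 3 ++ fibWord 3 →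
        [x] <:+: fibWord 4 ++ fibWord 4) x h
    | [x, y], _, h => exact (by decide : ∀ x y : Bool, [x, y] <:+: fibWord 3 ++ fibWord 3 →
        [x, y] <:+: fibWord 4 ++ fibWord 4) x y h
    | _ :: _ :: _ :: _, hl, _ => simp [fibWord] at hl
  | n+4, _, _, h =>
    refine h.trans (List.IsPrefix.isInfix ?_)
    refine ⟨fibWord (n+1) ++ fibWord (n+2) ++ fibWord (n+3), ?_⟩
    simp [fibWord]

theorem fibWord_len_aux (i : ℕ) (hi : 2 ≤ i) :
    (fibWord i).length ≤ (fibWord (i+1)).length := by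
  match i, hi with
  | n+2, _ => simp [fibWord]

/-- For 2 ≤ i < j, every factor of f_i f_i of length at most
|f_i| is a factor of f_j f_j (the trie of (f_i)_o is a subtree of that of
(f_j)_o). -/
theorem fibWord_trie_subtree (i j : ℕ) (hi : 2 ≤ i) (hij : i < j) :
    ∀ v : List Bool, v.length ≤ (fibWord i).length →
      v <:+: (fibWord i ++ fibWord i) → v <:+: (fibWord j ++ fibWord j) := by
  intro v hl h
  have key : ∀ k, (fibWord i).length ≤ (fibWord (i+k)).length ∧
      v <:+: (fibWord (i+k) ++ fibWord (i+k)) := by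
    intro k
    induction k with
    | zero => exact ⟨le_rfl, h⟩
    | succ k ih =>
      exact ⟨ih.1.trans (fibWord_len_aux (i+k) (by omega)),
        fibWord_step_aux (i+k) (by omega) v (hl.trans ih.1) ih.2⟩
  have := (key (j - i)).2
  rwa [show i + (j - i) = j by omega] at this
end

section
/- Let f_i be a finite Fibonacci word and suppose p and q are branching prefixes for f_i such that p is a proper prefix of q and there is no branching prefix r for f_i with p a proper prefix of r and r a proper prefix of q. Then |q| − |p| is a Fibonacci number, i.e., |q| − |p| = F_k for some k ≥ 1. -/
def fgC : ℕ → List Bool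
  | 0 => []
  | 1 => [true]
  | (n+2) => fgC (n+1) ++ ([!(n+1).bodd, (n+1).bodd] ++ fgC n)

theorem fgC_alt (n : ℕ) : fgC (n+2) = fgC n ++ ([!n.bodd, n.bodd] ++ fgC (n+1)) := by
  induction n with
  | zero => simp [fgC]
  | succ n ih =>
    have h1 : fgC (n+1+2) = fgC (n+2) ++ ([!(n+2).bodd, (n+2).bodd] ++ fgC (n+1)) := by
      simp only [fgC]
    rw [h1]
    conv_lhs => rw [show fgC (n+2) = fgC (n+1) ++ ([!(n+1).bodd, (n+1).bodd] ++ fgC n) from by simp only [fgC]]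
    rw [show n+1+1 = n+2 from rfl, ih]
    simp

theorem fgC_rev (n : ℕ) : (fgC n).reverse = fgC n ∧ (fgC (n+1)).reverse = fgC (n+1) := by
  induction n with
  | zero => simp [fgC]
  | succ n ih =>
    refine ⟨ih.2, ?_⟩
    rw [show n+1+1 = n+2 from rfl]
    conv_rhs => rw [fgC_alt]
    simp only [fgC, List.reverse_append, ih.1, ih.2]
    simp

theorem fgC_fib (n : ℕ) : fibWord (n+3) = fgC n ++ [!n.bodd, n.bodd] ∧
    fibWord (n+4) = fgC (n+1) ++ [!(n+1).bodd, (n+1).bodd] := by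
  induction n with
  | zero => simp [fgC, fibWord]
  | succ n ih =>
    refine ⟨ih.2, ?_⟩
    rw [show fibWord (n+1+4) = fibWord (n+4) ++ fibWord (n+3) from by
      rw [show n+1+4 = (n+2)+3 from rfl, fibWord], ih.1, ih.2]
    simp [fgC]

theorem fgC_len (n : ℕ) : (fgC n).length + 2 = Nat.fib (n+3) ∧
    (fgC (n+1)).length + 2 = Nat.fib (n+4) := by
  induction n with
  | zero => simp [fgC, Nat.fib]
  | succ n ih =>
    refine ⟨ih.2, ?_⟩
    have : Nat.fib (n+1+4) = Nat.fib (n+3) + Nat.fib (n+4) := Nat.fib_add_two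
    rw [this, ← ih.1, ← ih.2]
    simp [fgC]; omega

theorem fgC_pre_succ (n : ℕ) : fgC n <+: fgC (n+1) := by
  cases n with
  | zero => simp [fgC]
  | succ n => rw [show n+1+1 = n+2 from rfl]; simp only [fgC]; exact List.prefix_append _ _

theorem fgC_pre {n m : ℕ} (h : n ≤ m) : fgC n <+: fgC m := by
  induction h with
  | refl => exact List.prefix_rfl
  | step _ ih => exact ih.trans (fgC_pre_succ _)

theorem fgC_lt (n : ℕ) : n ≤ (fgC n).length ∧ n + 1 ≤ (fgC (n+1)).length := by
  induction n with
  | zero => simp [fgC]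
  | succ n ih =>
    refine ⟨ih.2, ?_⟩
    simp [fgC]; omega

def fgW (i : ℕ) : Bool := (fgC (i+1)).getD i false

theorem fgW_eq {n i : ℕ} (h : i < (fgC n).length) : (fgC n)[i]? = some (fgW i) := by
  have hi := (fgC_lt i).2
  have : (fgC (i+1))[i]? = some (fgW i) := by
    rw [fgW, List.getD_eq_getElem?_getD, List.getElem?_eq_getElem (by omega)]; rfl
  rw [← this]
  rcases le_total n (i+1) with h' | h'
  · obtain ⟨t, ht⟩ := fgC_pre h'
    rw [← ht, List.getElem?_append_left h]
  · obtain ⟨t, ht⟩ := fgC_pre h'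
    rw [← ht, List.getElem?_append_left (by omega)]

theorem fgW_per (n i : ℕ) (h : i < (fgC (n+1)).length) : fgW (i + Nat.fib (n+3)) = fgW i := by
  have h1 := (fgC_len n).1
  have h2 : i + Nat.fib (n+3) < (fgC (n+2)).length := by
    rw [fgC_alt]; simp; omega
  have h3 := fgW_eq h2
  rw [fgC_alt, List.getElem?_append_right (by omega), List.getElem?_append_right (by simp; omega)] at h3
  rw [show i + Nat.fib (n+3) - (fgC n).length - [!n.bodd, n.bodd].length = i by simp; omega, fgW_eq h] at h3
  exact (Option.some.inj h3).symm

theorem fgW_brk (n : ℕ) : fgW (fgC n).length = !n.bodd := by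
  have h2 : (fgC n).length < (fgC (n+2)).length := by rw [fgC_alt]; simp
  have h3 := fgW_eq h2
  rw [fgC_alt, List.getElem?_append_right (by omega)] at h3
  simp at h3
  rw [h3]; simp

theorem fgW_min (k : ℕ) : ∀ d, 1 ≤ d → (∀ i, i + d + 1 < Nat.fib (k+1) → fgW i = fgW (i+d)) →
    Nat.fib k ≤ d := by
  induction k using Nat.strong_induction_on with
  | _ k IH =>
  intro d hd hper
  by_cases hk : k < 3
  · interval_cases k <;> simp [Nat.fib] <;> omega
  obtain ⟨n, rfl⟩ : ∃ n, k = n + 3 := ⟨k-3, by omega⟩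
  by_contra hlt
  push Not at hlt
  have e4 : Nat.fib (n+4) = Nat.fib (n+2) + Nat.fib (n+3) := Nat.fib_add_two
  have e3 : Nat.fib (n+3) = Nat.fib (n+1) + Nat.fib (n+2) := Nat.fib_add_two
  have p1 : 0 < Nat.fib (n+1) := Nat.fib_pos.2 (by omega)
  have p2 : 0 < Nat.fib (n+2) := Nat.fib_pos.2 (by omega)
  have h1 := IH (n+2) (by omega) d hd (fun i hi => hper i (by
    rw [show n+2+1 = n+3 from rfl] at hi; rw [show n+3+1 = n+4 from rfl]; omega))
  rw [show n+3+1 = n+4 from rfl] at hper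
  have l := fgC_len n
  rcases eq_or_lt_of_le h1 with h1 | h1
  · subst h1
    have := hper (fgC n).length (by omega)
    rw [show (fgC n).length + Nat.fib (n+2) = (fgC (n+1)).length by omega, fgW_brk, fgW_brk] at this
    simp at this
  · have := IH (n+1) (by omega) (d - Nat.fib (n+2)) (by omega) (fun i hi => by
      rw [show n+1+1 = n+2 from rfl] at hi
      rw [hper i (by omega)]
      obtain ⟨e, rfl⟩ : ∃ e, d = e + Nat.fib (n+2) := ⟨d - Nat.fib (n+2), by omega⟩
      rw [Nat.add_sub_cancel] at *
      cases n with
      | zero => simp [Nat.fib] at *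
      | succ n =>
        rw [← add_assoc]
        exact fgW_per n (i+e) (by have := (fgC_len n).2; rw [show n+1+3 = n+4 from rfl, show n+1+2=n+3 from rfl, show n+1+1=n+2 from rfl] at *; omega))
    omega

def fgR (m : ℕ) : List Bool := ((List.range m).map fgW).reverse

theorem fgR_len (m : ℕ) : (fgR m).length = m := by simp [fgR]

theorem fgR_succ (m : ℕ) : fgR (m+1) = fgW m :: fgR m := by
  simp [fgR, List.range_succ]

theorem fgR_suf {m k : ℕ} (h : m ≤ k) : fgR m <:+ fgR k := by
  induction h with
  | refl => exact List.suffix_rfl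
  | step _ ih => rw [fgR_succ]; exact ih.trans (List.suffix_cons _ _)

theorem fgC_eq_R (n : ℕ) : fgC n = fgR (fgC n).length := by
  rw [fgR, ← List.reverse_inj, (fgC_rev n).1, List.reverse_reverse]
  apply List.ext_getElem?
  intro i
  by_cases h : i < (fgC n).length
  · rw [fgW_eq h]; simp [h]
  · rw [List.getElem?_eq_none (by omega), List.getElem?_eq_none (by simp; omega)]

theorem fgR_pre (m d : ℕ) : fgR m <+: fgR (m+d) ↔ ∀ i < m, fgW i = fgW (i+d) := by
  rw [fgR, fgR, List.reverse_prefix, List.suffix_iff_eq_drop]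
  simp only [List.length_map, List.length_range, Nat.add_sub_cancel_left]
  constructor
  · intro h i hi
    have := congrArg (fun l => l[i]?) h
    simp [hi, List.getElem?_range, List.getElem?_drop, show d + i < m + d by omega] at this
    rw [this, add_comm]
  · intro h
    apply List.ext_getElem
    · simp
    · intro i h1 h2
      simp at h1
      simp [h i h1, add_comm]

def fgBr (S : Finset (List Bool)) (p : List Bool) : Prop :=
  ∃ c d : Bool, c ≠ d ∧ (∃ v ∈ S, (p ++ [c]) <+: v) ∧ (∃ v ∈ S, (p ++ [d]) <+: v)

theorem fg_same {p x : List Bool} {c d : Bool} (h1 : p ++ [c] <+: x) (h2 : p ++ [d] <+: x) : c = d := by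
  have := List.prefix_of_prefix_length_le h1 h2 (by simp)
  have := this.eq_of_length (by simp)
  simpa using this

theorem fg_new {S : Finset (List Bool)} {x p : List Bool} (h : fgBr (insert x S) p)
    (hn : ¬ fgBr S p) : ∃ c d, c ≠ d ∧ p ++ [c] <+: x ∧ ∃ v ∈ S, p ++ [d] <+: v := by
  obtain ⟨c, d, hcd, ⟨v, hv, hpv⟩, ⟨u, hu, hpu⟩⟩ := h
  rcases Finset.mem_insert.1 hv with h1 | hv
  · subst h1
    rcases Finset.mem_insert.1 hu with rfl | hu
    · exact absurd (fg_same hpv hpu) hcd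
    · exact ⟨c, d, hcd, hpv, u, hu, hpu⟩
  · rcases Finset.mem_insert.1 hu with h1 | hu
    · subst h1
      exact ⟨d, c, hcd.symm, hpu, v, by assumption, hpv⟩
    · exact absurd ⟨c, d, hcd, ⟨v, hv, hpv⟩, ⟨u, hu, hpu⟩⟩ hn

theorem fg_new_lt {S : Finset (List Bool)} {x p q : List Bool} (h : fgBr (insert x S) p)
    (hn : ¬ fgBr S p) (h' : fgBr (insert x S) q)
    (hn' : ¬ fgBr S q) : ¬ p.length < q.length := by
  intro hl
  obtain ⟨c, d, hcd, hc, u, hu, hd⟩ := fg_new h hn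
  obtain ⟨c', d', hcd', hc', u', hu', hd'⟩ := fg_new h' hn'
  have : p ++ [c] <+: q := List.prefix_of_prefix_length_le hc
    ((List.prefix_append q [c']).trans hc') (by simp; omega)
  exact hn ⟨c, d, hcd, ⟨u', hu', this.trans ((List.prefix_append q [d']).trans hd')⟩, u, hu, hd⟩

theorem fg_new_eq {S : Finset (List Bool)} {x p q : List Bool} (h : fgBr (insert x S) p)
    (hn : ¬ fgBr S p) (h' : fgBr (insert x S) q)
    (hn' : ¬ fgBr S q) : p = q := by
  have h1 := fg_new_lt h hn h' hn'
  have h2 := fg_new_lt h' hn' h hn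
  obtain ⟨c, d, hcd, hc, u, hu, hd⟩ := fg_new h hn
  obtain ⟨c', d', hcd', hc', u', hu', hd'⟩ := fg_new h' hn'
  exact (List.prefix_of_prefix_length_le ((List.prefix_append p [c]).trans hc)
    ((List.prefix_append q [c']).trans hc') (by omega)).eq_of_length (by omega)

theorem fg_count (S : Finset (List Bool)) (hS : S.Nonempty) :
    ∃ T : Finset (List Bool), (∀ p, fgBr S p → p ∈ T) ∧ T.card + 1 ≤ S.card := by
  induction hS using Finset.Nonempty.cons_induction with
  | singleton a =>
    refine ⟨∅, ?_, by simp⟩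
    rintro p ⟨c, d, hcd, ⟨v, hv, hpv⟩, ⟨u, hu, hpu⟩⟩
    rw [Finset.mem_singleton] at hv hu
    subst hv hu
    exact absurd (fg_same hpv hpu) hcd
  | cons a s ha hs ih =>
    obtain ⟨T, hT, hc⟩ := ih
    rw [Finset.cons_eq_insert, Finset.card_insert_of_notMem ha]
    by_cases h : ∃ p, fgBr (insert a s) p ∧ ¬ fgBr s p
    · obtain ⟨p, hp, hn⟩ := h
      refine ⟨insert p T, ?_, by have := Finset.card_insert_le p T; omega⟩
      intro q hq
      by_cases hq' : fgBr s q
      · exact Finset.mem_insert_of_mem (hT q hq')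
      · rw [fg_new_eq hq hq' hp hn]; exact Finset.mem_insert_self _ _
    · push Not at h
      exact ⟨T, fun p hp => hT p (h p hp), by omega⟩

theorem fg_conj (n : ℕ) : IsConjugate (fgC n ++ [n.bodd, !n.bodd]) (fibWord (n+3)) := by
  cases n with
  | zero => exact ⟨[false], [true], by simp [fgC], by simp [fibWord]⟩
  | succ n =>
    cases n with
    | zero => exact ⟨[true], [true, false], by simp [fgC], by simp [fibWord]⟩
    | succ n =>
      refine ⟨fibWord (n+3), fibWord (n+4), ?_, ?_⟩
      · rw [(fgC_fib n).1, (fgC_fib n).2, show n+1+1 = n+2 from rfl, fgC_alt]; simp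
      · rw [show n+1+1+3 = (n+2)+3 from rfl, fibWord]

theorem fg_conj_rot {x y : List Bool} (h : IsConjugate x y) :
    ∃ k < y.length + 1, x = y.rotate k := by
  obtain ⟨s, t, rfl, rfl⟩ := h
  exact ⟨t.length, by rw [List.length_append]; omega, by rw [List.rotate_append_length_eq]⟩

theorem fg_rot_conj (y : List Bool) (k : ℕ) (h : k ≤ y.length) : IsConjugate (y.rotate k) y :=
  ⟨y.drop k, y.take k, by rw [List.rotate_eq_drop_append_take h], by simp⟩

theorem fg_isConj_trans {x y z : List Bool} (h : IsConjugate x y) (h' : IsConjugate y z) :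
    IsConjugate x z := by
  obtain ⟨k, _, rfl⟩ := fg_conj_rot h
  obtain ⟨j, _, rfl⟩ := fg_conj_rot h'
  rw [List.rotate_rotate, ← List.rotate_mod]
  by_cases hz : z = []
  · subst hz; exact ⟨[], [], by simp, by simp⟩
  · exact fg_rot_conj _ _ (Nat.mod_lt _ (List.length_pos_iff.2 hz)).le

theorem fg_R_branch (n m : ℕ) (hm : m ≤ (fgC n).length) :
    IsBranchingPrefix (fgR m) (fibWord (n+3)) := by
  have h := fgR_suf hm
  rw [← fgC_eq_R] at h
  obtain ⟨u, hu⟩ := h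
  refine ⟨!n.bodd, n.bodd, by simp, ⟨fgR m ++ [!n.bodd, n.bodd] ++ u, ?_, ?_⟩,
    ⟨fgR m ++ [n.bodd, !n.bodd] ++ u, ?_, ?_⟩⟩
  · refine ⟨_, _, rfl, ?_⟩
    rw [(fgC_fib n).1, ← hu]; simp
  · exact ⟨n.bodd :: u, by simp⟩
  · refine fg_isConj_trans ?_ (fg_conj n)
    refine ⟨_, _, rfl, ?_⟩
    rw [← hu]; simp
  · exact ⟨(!n.bodd) :: u, by simp⟩

theorem fg_branch_R (n : ℕ) (p : List Bool) (hp : IsBranchingPrefix p (fibWord (n+3))) :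
    ∃ m ≤ (fgC n).length, p = fgR m := by
  have hlen : (fibWord (n+3)).length = (fgC n).length + 2 := by rw [(fgC_fib n).1]; simp
  set w := fibWord (n+3) with hw
  let S : Finset (List Bool) := (Finset.range w.length).image (fun k => w.rotate k)
  have hS : ∀ v, IsConjugate v w → v ∈ S := by
    intro v hv
    obtain ⟨k, _, rfl⟩ := fg_conj_rot hv
    exact Finset.mem_image.2 ⟨k % w.length, Finset.mem_range.2 (Nat.mod_lt _ (by omega)),
      List.rotate_mod _ _⟩
  have hB : ∀ p, IsBranchingPrefix p w → fgBr S p := by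
    rintro p ⟨c, d, hcd, ⟨v, hv, hpv⟩, ⟨u, hu, hpu⟩⟩
    exact ⟨c, d, hcd, ⟨v, hS v hv, hpv⟩, ⟨u, hS u hu, hpu⟩⟩
  have hSc : S.card ≤ w.length := Finset.card_image_le.trans (by simp)
  obtain ⟨T, hT, hc⟩ := fg_count S ⟨w, hS w ⟨[], w, by simp, by simp⟩⟩
  let U : Finset (List Bool) := (Finset.range ((fgC n).length + 1)).image fgR
  have hU : U.card = (fgC n).length + 1 := by
    rw [Finset.card_image_of_injective, Finset.card_range]
    intro a b hab
    rw [← fgR_len a, hab, fgR_len]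
  have hUT : U ⊆ T := by
    intro x hx
    obtain ⟨m, hm, rfl⟩ := Finset.mem_image.1 hx
    exact hT _ (hB _ (fg_R_branch n m (by rw [Finset.mem_range] at hm; omega)))
  have hEq := Finset.eq_of_subset_of_card_le hUT (by omega)
  have : p ∈ U := hEq ▸ hT _ (hB p hp)
  obtain ⟨m, hm, rfl⟩ := Finset.mem_image.1 this
  exact ⟨m, by rw [Finset.mem_range] at hm; omega, rfl⟩

theorem fg_small {a : Bool} {p : List Bool} (h : IsBranchingPrefix p [a]) : False := by
  obtain ⟨c, d, hcd, ⟨v, hv, hpv⟩, ⟨u, hu, hpu⟩⟩ := h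
  obtain ⟨k, _, rfl⟩ := fg_conj_rot hv
  obtain ⟨j, _, rfl⟩ := fg_conj_rot hu
  rw [List.rotate_singleton] at hpv hpu
  exact hcd (fg_same hpv hpu)

theorem fg_find (m : ℕ) (hm : 1 ≤ m) : ∃ n, Nat.fib (n+3) ≤ m + 1 ∧ m + 2 ≤ Nat.fib (n+4) := by
  induction m, hm using Nat.le_induction with
  | base => exact ⟨0, by simp [Nat.fib]⟩
  | succ m hm ih =>
    obtain ⟨n, h1, h2⟩ := ih
    by_cases h : m + 1 + 2 ≤ Nat.fib (n+4)
    · exact ⟨n, by omega, h⟩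
    · have : Nat.fib (n+5) = Nat.fib (n+3) + Nat.fib (n+4) := Nat.fib_add_two
      have := Nat.fib_pos.2 (show 0 < n+3 by omega)
      exact ⟨n+1, by rw [show n+1+3=n+4 from rfl]; omega, by rw [show n+1+4=n+5 from rfl]; omega⟩

theorem fgW_per' (n i : ℕ) (h : i + 2 < Nat.fib (n+3)) : fgW i = fgW (i + Nat.fib (n+2)) := by
  cases n with
  | zero => simp [Nat.fib] at h
  | succ n =>
    have := (fgC_len n).2
    exact (fgW_per n i (by rw [show n+1+3=n+4 from rfl] at h; omega)).symm

/-- If p and q are branching prefixes for f_i with p a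
proper prefix of q and no branching prefix strictly between them, then
|q| - |p| is a Fibonacci number F_k with k ≥ 1. -/
theorem fibWord_branching_gap_is_fib (i : ℕ) (p q : List Bool)
    (hp : IsBranchingPrefix p (fibWord i)) (hq : IsBranchingPrefix q (fibWord i))
    (hpq_pre : p <+: q) (hpq_ne : p ≠ q)
    (hno : ¬ ∃ r : List Bool, IsBranchingPrefix r (fibWord i) ∧
      p <+: r ∧ p ≠ r ∧ r <+: q ∧ r ≠ q) :
    ∃ k : ℕ, 1 ≤ k ∧ q.length - p.length = Nat.fib k := by
  match i, hp, hq, hno with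
  | 0, hp, _, _ =>
    obtain ⟨c, d, hcd, ⟨v, ⟨s, t, h1, h2⟩, hpv⟩, _⟩ := hp
    have h2 := congrArg List.length h2
    have h1 := congrArg List.length h1
    have h3 := hpv.length_le
    simp only [fibWord, List.length_append, List.length_nil, List.length_singleton] at h1 h2 h3
    omega
  | 1, hp, _, _ => exact (fg_small (a := false) hp).elim
  | 2, hp, _, _ => exact (fg_small (a := true) hp).elim
  | n+3, hp, hq, hno =>
    obtain ⟨j, hj, rfl⟩ := fg_branch_R n p hp
    obtain ⟨m, hm, rfl⟩ := fg_branch_R n q hq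
    have hle := hpq_pre.length_le
    rw [fgR_len, fgR_len] at *
    have hne : j ≠ m := fun h => hpq_ne (by rw [h])
    obtain ⟨d, rfl⟩ : ∃ d, m = j + d := ⟨m - j, by omega⟩
    obtain ⟨k, hk1, hk2⟩ := fg_find (j+d) (by omega)
    have hper := (fgR_pre j d).1 hpq_pre
    have hmin := fgW_min (k+2) d (by omega) (fun i hi => hper i (by
      rw [show k+2+1 = k+3 from rfl] at hi; omega))
    refine ⟨k+2, by omega, ?_⟩
    rw [Nat.add_sub_cancel_left]
    by_contra hcon
    apply hno
    have e4 : Nat.fib (k+4) = Nat.fib (k+2) + Nat.fib (k+3) := Nat.fib_add_two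
    have pos : 0 < Nat.fib (k+2) := Nat.fib_pos.2 (by omega)
    obtain ⟨e, he⟩ : ∃ e, d = e + Nat.fib (k+2) := ⟨d - Nat.fib (k+2), by omega⟩
    have hb : fgR (j+e) <+: fgR (j+d) := by
      rw [he, ← add_assoc, fgR_pre]
      intro i hi
      exact fgW_per' k i (by omega)
    have hinj : ∀ a b, a ≠ b → fgR a ≠ fgR b := fun a b hab h => hab (by
      rw [← fgR_len a, h, fgR_len])
    refine ⟨fgR (j+e), fg_R_branch n _ (by omega), ?_, hinj _ _ (by omega), hb, hinj _ _ (by omega)⟩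
    exact List.prefix_of_prefix_length_le hpq_pre hb (by rw [fgR_len, fgR_len]; omega)
end

section
/- For every i ≥ 2 there exists an index j > i such that the square f_i f_i of the i-th finite Fibonacci word is a factor of the finite Fibonacci word f_j (and hence f_i f_i is a factor of the infinite Fibonacci word). -/
/-- For every i ≥ 2 there is j > i such that f_i f_i is a
factor of f_j. -/
theorem fibWord_square_is_factor (i : ℕ) (hi : 2 ≤ i) :
    ∃ j : ℕ, i < j ∧ (fibWord i ++ fibWord i) <:+: fibWord j := by
  obtain ⟨n, rfl⟩ := Nat.exists_eq_add_of_le' hi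
  refine ⟨n + 5, by omega, fibWord (n + 3), fibWord (n + 1), ?_⟩
  have h5 : fibWord (n + 5) = fibWord (n + 4) ++ fibWord (n + 3) := by rw [fibWord]
  have h4 : fibWord (n + 4) = fibWord (n + 3) ++ fibWord (n + 2) := by rw [fibWord]
  have h3 : fibWord (n + 3) = fibWord (n + 2) ++ fibWord (n + 1) := by rw [fibWord]
  rw [h5, h4, h3]
  simp only [List.append_assoc]
end

section
/- For every i ≥ 1 and every integer k with 0 ≤ k ≤ |f_i|, the number of distinct factors of length k of the word f_i f_i is at most k + 1; equivalently, the circular Fibonacci word (f_i)_o has at most k + 1 distinct length-k factors. -/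
def phiW : List Bool → List Bool
  | [] => []
  | true :: w => true :: false :: phiW w
  | false :: w => true :: phiW w

theorem phiW_append (x y : List Bool) : phiW (x ++ y) = phiW x ++ phiW y := by
  induction x with
  | nil => rfl
  | cons c x ih => cases c <;> simp [phiW, ih]

theorem phiW_fib (n : ℕ) : phiW (fibWord (n+1)) = fibWord (n+2) ∧
    phiW (fibWord (n+2)) = fibWord (n+3) := by
  induction n with
  | zero => simp [fibWord, phiW]
  | succ n ih =>
    refine ⟨ih.2, ?_⟩
    have h1 : fibWord (n+1+2) = fibWord (n+2) ++ fibWord (n+1) := rfl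
    have h2 : fibWord (n+1+3) = fibWord (n+3) ++ fibWord (n+2) := rfl
    rw [h1, h2, phiW_append, ih.1, ih.2]

theorem phiW_head (x : List Bool) (s : List Bool) : phiW x ≠ false :: s := by
  rcases x with _ | ⟨_ | _, x⟩ <;> simp [phiW]

theorem phiW_inj (x y : List Bool) (h : phiW x = phiW y) : x = y := by
  induction x generalizing y with
  | nil => rcases y with _ | ⟨_ | _, y⟩ <;> simp_all [phiW]
  | cons c x ih =>
    rcases c with _ | _ <;> rcases y with _ | ⟨_ | _, y⟩ <;> simp [phiW] at h ⊢
    · exact ih _ h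
    · exact (phiW_head _ _ h).elim
    · exact (phiW_head _ _ h.symm).elim
    · exact ih _ h

theorem phiW_split (x p q : List Bool) (h : phiW x = p ++ true :: q) :
    ∃ x1 x2, x = x1 ++ x2 ∧ phiW x1 = p ∧ phiW x2 = true :: q := by
  induction x generalizing p with
  | nil => simp [phiW] at h
  | cons c x ih =>
    rcases p with _ | ⟨d, p⟩
    · exact ⟨[], c :: x, rfl, rfl, by simpa using h⟩
    · rcases c with _ | _
      · simp [phiW] at h
        obtain ⟨x1, x2, rfl, h1, h2⟩ := ih p h.2
        exact ⟨false :: x1, x2, rfl, by simp [phiW, h1, ← h.1], h2⟩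
      · rcases p with _ | ⟨e, p⟩
        · simp [phiW] at h
        · simp [phiW] at h
          obtain ⟨x1, x2, rfl, h1, h2⟩ := ih p h.2.2
          exact ⟨true :: x1, x2, rfl, by simp [phiW, h1, ← h.1, ← h.2.1], h2⟩

theorem phiW_last (x p : List Bool) (c : Bool) (h : phiW x = p ++ [c]) :
    ∃ y, x = y ++ [!c] := by
  rcases List.eq_nil_or_concat' x with rfl | ⟨y, d, rfl⟩
  · simp [phiW] at h
  · refine ⟨y, ?_⟩
    rw [phiW_append] at h
    cases d
    · have := congrArg List.getLast? h
      simp [phiW] at this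
      simp [← this]
    · have := congrArg List.getLast? h
      simp [phiW] at this
      simp [← this]

theorem phiW_noff (x p q : List Bool) : phiW x ≠ p ++ false :: false :: q := by
  induction x generalizing p with
  | nil => simp [phiW]
  | cons c x ih =>
    intro h
    rcases c with _ | _ <;> rcases p with _ | ⟨d, _ | ⟨e, p⟩⟩ <;> simp [phiW] at h
    · exact phiW_head _ _ h.2
    · exact ih (e :: p) h.2
    · exact phiW_head _ _ h.2
    · exact ih _ h.2.2

def BalW (x : List Bool) : Prop := ∀ w : List Bool,
  true :: (w ++ [true]) <:+: x → false :: (w ++ [false]) <:+: x → False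

theorem BalW_phi (x : List Bool) (hx : BalW x) : BalW (phiW x) := by
  rintro w ⟨p, s, hp⟩ ⟨p', s', hp'⟩
  rcases List.eq_nil_or_concat' w with rfl | ⟨w', d, rfl⟩
  · exact phiW_noff x p' s' (by simp [← hp'])
  have hd : d = true := by
    cases d
    · exact (phiW_noff x (p' ++ false :: w') s' (by simp [← hp'])).elim
    · rfl
  subst hd
  -- the part after the first letter starts with `true`
  have hst : ∃ r, w' ++ [true] = true :: r := by
    rcases w' with _ | ⟨_ | _, w'⟩
    · exact ⟨[], rfl⟩
    · exact (phiW_noff x p' (w' ++ true :: false :: s') (by simp [← hp'])).elim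
    · exact ⟨_, rfl⟩
  obtain ⟨r, hr⟩ := hst
  have key : ∀ (c : Bool) (p s : List Bool), p ++ c :: ((w' ++ [true]) ++ [c]) ++ s = phiW x →
      ∃ z, phiW z = w' ∧ (!c) :: (z ++ [!c]) <:+: x := by
    intro c p s h
    obtain ⟨x1, x2, rfl, h1, h2⟩ := phiW_split x (p ++ [c]) (r ++ c :: s)
      (by rw [← h, hr]; simp)
    have h3 : phiW x2 = w' ++ true :: (c :: s) := by
      rw [h2, ← List.cons_append, ← hr]; simp
    obtain ⟨z, x3, rfl, h4, h5⟩ := phiW_split x2 w' _ h3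
    obtain ⟨y, rfl⟩ := phiW_last _ _ _ h1
    refine ⟨z, h4, ?_⟩
    have : ∃ t, x3 = (!c) :: t := by
      rcases x3 with _ | ⟨_ | _, t⟩ <;> cases c <;> simp [phiW] at h5 ⊢
      exact phiW_head _ _ h5
    obtain ⟨t, rfl⟩ := this
    exact ⟨y, t, by simp⟩
  obtain ⟨z, hz, h1⟩ := key true p s (by simpa using hp)
  obtain ⟨z', hz', h2⟩ := key false p' s' (by simpa using hp')
  obtain rfl := phiW_inj z z' (hz.trans hz'.symm)
  exact hx z (by simpa using h2) (by simpa using h1)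

theorem BalW_fib (n : ℕ) : BalW (fibWord (n+1)) := by
  induction n with
  | zero =>
    rintro w h -
    have := h.length_le
    simp [fibWord] at this
  | succ n ih => rw [← (phiW_fib n).1]; exact BalW_phi _ ih

theorem split_ne (u v : List Bool) (hl : u.length = v.length) (h : u ≠ v) :
    ∃ (s : List Bool) (c : Bool), s ++ [c] <+: u ∧ s ++ [!c] <+: v := by
  induction u generalizing v with
  | nil => simp at hl; exact (h (List.length_eq_zero_iff.1 hl.symm).symm).elim
  | cons a u ih =>
    rcases v with _ | ⟨b, v⟩
    · simp at hl
    · by_cases hab : a = b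
      · subst hab
        obtain ⟨s, c, h1, h2⟩ := ih v (by simpa using hl) (by simpa using h)
        exact ⟨a :: s, c, by simpa using h1, by simpa using h2⟩
      · have : b = !a := by cases a <;> cases b <;> simp_all
        subst this
        exact ⟨[], a, by simp, by simp⟩

def FacW (x : List Bool) (k : ℕ) : Set (List Bool) := {v | v.length = k ∧ v <:+: x}

theorem FacW_fin (x : List Bool) (k : ℕ) : (FacW x k).Finite :=
  (List.finite_length_eq Bool k).subset fun _ h => h.1

theorem FacW_card (x : List Bool) (hx : BalW x) (k : ℕ) : (FacW x k).ncard ≤ k + 1 := by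
  induction k with
  | zero =>
    rw [Set.ncard_le_one (FacW_fin x 0)]
    rintro a ⟨ha, -⟩ b ⟨hb, -⟩
    rw [List.length_eq_zero_iff] at ha hb
    rw [ha, hb]
  | succ k ih =>
    let T (c : Bool) : Set (List Bool) := {v | c :: v ∈ FacW x (k+1)}
    have hT : ∀ c, T c ⊆ FacW x k := by
      rintro c v ⟨h1, h2⟩
      exact ⟨by simpa using h1, (List.suffix_cons c v).isInfix.trans h2⟩
    have hf : ∀ c, (T c).Finite := fun c => (FacW_fin x k).subset (hT c)
    have hE : FacW x (k+1) ⊆ (List.cons true '' T true) ∪ (List.cons false '' T false) := by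
      rintro (_ | ⟨_ | _, v⟩) hv
      · simp [FacW] at hv
      · exact Or.inr ⟨v, hv, rfl⟩
      · exact Or.inl ⟨v, hv, rfl⟩
    have h1 := Set.ncard_le_ncard hE (((hf true).image _).union ((hf false).image _))
    have h2 := Set.ncard_union_le (List.cons true '' T true) (List.cons false '' T false)
    have h3 := Set.ncard_image_le (f := List.cons true) (hf true)
    have h4 := Set.ncard_image_le (f := List.cons false) (hf false)
    have h5 := Set.ncard_union_add_ncard_inter (T true) (T false) (hf true) (hf false)
    have h6 := Set.ncard_le_ncard (Set.union_subset (hT true) (hT false)) (FacW_fin x k)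
    have h7 : (T true ∩ T false).ncard ≤ 1 := by
      rw [Set.ncard_le_one ((hf true).subset Set.inter_subset_left)]
      rintro u ⟨hu1, hu2⟩ v ⟨hv1, hv2⟩
      by_contra hne
      obtain ⟨s, c, hs1, hs2⟩ := split_ne u v
        ((hT _ hu1).1.trans (hT _ hv1).1.symm) hne
      have tr : ∀ (c : Bool) (p q : List Bool), p <+: q → q ∈ T c → c :: p <:+: x :=
        fun c p q h hq => ((List.prefix_cons_inj c).2 h).isInfix.trans hq.2
      cases c
      · exact hx s (tr _ _ _ hs2 hv1) (tr _ _ _ hs1 hu2)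
      · exact hx s (tr _ _ _ hs1 hu1) (tr _ _ _ hs2 hv2)
    omega

/-- For i ≥ 1 and k ≤ |f_i|, the word f_i f_i has at most
k + 1 distinct factors of length k. -/
theorem fibWord_factor_complexity (i k : ℕ) (hi : 1 ≤ i) (hk : k ≤ (fibWord i).length) :
    {v : List Bool | v.length = k ∧ v <:+: (fibWord i ++ fibWord i)}.ncard ≤ k + 1 := by
  rcases i with _ | _ | n
  · omega
  · refine FacW_card _ ?_ k
    rintro w h -
    have := h.subset (List.mem_cons_self)
    simp [fibWord] at this
  · have hsq : fibWord (n+2) ++ fibWord (n+2) <:+: fibWord (n+5) := by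
      have e5 : fibWord (n+5) = fibWord (n+4) ++ fibWord (n+3) := rfl
      have e4 : fibWord (n+4) = fibWord (n+3) ++ fibWord (n+2) := rfl
      have e3 : fibWord (n+3) = fibWord (n+2) ++ fibWord (n+1) := rfl
      refine ⟨fibWord (n+3), fibWord (n+1), ?_⟩
      rw [e5, e4]
      nth_rewrite 3 [e3]
      simp
    have hsub : {v : List Bool | v.length = k ∧ v <:+: (fibWord (n+2) ++ fibWord (n+2))} ⊆
        FacW (fibWord (n+5)) k := fun v hv => ⟨hv.1, hv.2.trans hsq⟩
    exact (Set.ncard_le_ncard hsub (FacW_fin _ k)).trans (FacW_card _ (BalW_fib (n+4)) k)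
end
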